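/- arXiv:2205.05148 — 2 statements merged into one kernel-verified Lean document; each statement's English description precedes it below -/
import Mathlib

section
/- Let Q be a quasivariety, B ∈ Q, A a substructure of B, and Θ ∈ Con_Q A meet-irreducible with Cg_Q^B(Θ) ∩ (A×A) = Θ. Then there exists a meet-irreducible Φ ∈ Con_Q B such that Φ ∩ (A×A) = Θ. -/
open FirstOrder Language Set

universe u

namespace Transfer

variable (L : FirstOrder.Language.{u, u})

/-- A bundled `L`-structure with carrier in universe `u`. -/
structure Struc : Type (u + 1) where
  Carrier : Type u
  [str : L.Structure Carrier]

attribute [instance] Struc.str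

/-- Product structure on a Pi type. -/
instance piStructure {ι : Type u} (M : ι → Type u) [∀ i, L.Structure (M i)] :
    L.Structure (∀ i, M i) where
  funMap f x i := Structure.funMap f fun j => x j i
  RelMap r x := ∀ i, Structure.RelMap r fun j => x j i

/-- Product structure on a binary product. -/
instance prodStructure (M N : Type u) [L.Structure M] [L.Structure N] :
    L.Structure (M × N) where
  funMap f x := (Structure.funMap f fun j => (x j).1, Structure.funMap f fun j => (x j).2)
  RelMap r x := Structure.RelMap r (fun j => (x j).1) ∧ Structure.RelMap r (fun j => (x j).2)

variable {L}

/-- The bundled structure on a substructure. -/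
abbrev ofSub (B : Struc L) (S : L.Substructure B.Carrier) : Struc L := ⟨S⟩

/-- The kernel of a map, as a set of pairs. -/
def kerSet {α β : Type u} (f : α → β) : Set (α × α) := {p | f p.1 = f p.2}

/-- The restriction of a binary relation on `B` to a substructure `S`. -/
def restrict {B : Struc L} (S : L.Substructure B.Carrier)
    (Θ : Set (B.Carrier × B.Carrier)) : Set ((ofSub B S).Carrier × (ofSub B S).Carrier) :=
  {p | ((p.1 : B.Carrier), (p.2 : B.Carrier)) ∈ Θ}

/-- The image of a binary relation on a substructure `S` in `B`. -/
def lift {B : Struc L} (S : L.Substructure B.Carrier)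
    (Θ : Set ((ofSub B S).Carrier × (ofSub B S).Carrier)) : Set (B.Carrier × B.Carrier) :=
  (fun p => ((p.1 : B.Carrier), (p.2 : B.Carrier))) '' Θ

/-- The set of `Q`-congruences of `A`: kernels of homomorphisms into members of `Q`. -/
def ConQ (Q : Set (Struc L)) (A : Struc L) : Set (Set (A.Carrier × A.Carrier)) :=
  {θ | ∃ M ∈ Q, ∃ f : A.Carrier →[L] M.Carrier, θ = kerSet f}

/-- The least `Q`-congruence of `A` containing `R`. -/
def cgQ (Q : Set (Struc L)) (A : Struc L) (R : Set (A.Carrier × A.Carrier)) :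
    Set (A.Carrier × A.Carrier) :=
  ⋂₀ {θ | θ ∈ ConQ Q A ∧ R ⊆ θ}

/-- The join of two `Q`-congruences in `Con_Q A`. -/
def joinQ (Q : Set (Struc L)) (A : Struc L) (θ φ : Set (A.Carrier × A.Carrier)) :
    Set (A.Carrier × A.Carrier) :=
  cgQ Q A (θ ∪ φ)

/-- `θ` is a meet-irreducible element of `Con_Q A`. -/
def MeetIrred (Q : Set (Struc L)) (A : Struc L) (θ : Set (A.Carrier × A.Carrier)) : Prop :=
  θ ∈ ConQ Q A ∧
    ∀ θ₁ ∈ ConQ Q A, ∀ θ₂ ∈ ConQ Q A, θ = θ₁ ∩ θ₂ → θ = θ₁ ∨ θ = θ₂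

/-- `θ` is a completely meet-irreducible element of `Con_Q A`. -/
def CompletelyMeetIrred (Q : Set (Struc L)) (A : Struc L)
    (θ : Set (A.Carrier × A.Carrier)) : Prop :=
  θ ∈ ConQ Q A ∧
    ∀ S ⊆ ConQ Q A, θ = ⋂₀ S → θ ∈ S

/-- The class of relatively finitely subdirectly irreducible members of `Q`. -/
def RFSI (Q : Set (Struc L)) : Set (Struc L) :=
  {A | A ∈ Q ∧ MeetIrred Q A (Set.diagonal A.Carrier)}

/-- The class of relatively subdirectly irreducible members of `Q`. -/
def RSI (Q : Set (Struc L)) : Set (Struc L) :=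
  {A | A ∈ Q ∧ CompletelyMeetIrred Q A (Set.diagonal A.Carrier)}

/-- `B` has the `Q`-congruence extension property. -/
def HasQCEP (Q : Set (Struc L)) (B : Struc L) : Prop :=
  ∀ S : L.Substructure B.Carrier, ∀ θ ∈ ConQ Q (ofSub B S),
    ∃ Φ ∈ ConQ Q B, restrict S Φ = θ

/-- A class `K` of members of `Q` has the `Q`-congruence extension property. -/
def ClassQCEP (Q K : Set (Struc L)) : Prop :=
  ∀ B ∈ K, HasQCEP Q B

variable (L)

/-- `Q` is a quasivariety: closed under isomorphisms, substructures, direct products,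
and ultraproducts. -/
def IsQuasivariety (Q : Set (Struc L)) : Prop :=
  (∀ A ∈ Q, ∀ B : Struc L, Nonempty (A.Carrier ≃[L] B.Carrier) → B ∈ Q) ∧
  (∀ B ∈ Q, ∀ S : L.Substructure B.Carrier, ofSub B S ∈ Q) ∧
  (∀ (ι : Type u) (f : ι → Struc L), (∀ i, f i ∈ Q) →
    (⟨∀ i, (f i).Carrier⟩ : Struc L) ∈ Q) ∧
  (∀ (ι : Type u) (f : ι → Struc L) (U : Ultrafilter ι), (∀ i, f i ∈ Q) →
    (⟨(U : Filter ι).Product fun i => (f i).Carrier⟩ : Struc L) ∈ Q)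

/-- `V` is a variety: closed under homomorphic images, substructures, and direct products. -/
def IsVariety (V : Set (Struc L)) : Prop :=
  (∀ A ∈ V, ∀ B : Struc L, ∀ f : A.Carrier →[L] B.Carrier, Function.Surjective f → B ∈ V) ∧
  (∀ B ∈ V, ∀ S : L.Substructure B.Carrier, ofSub B S ∈ V) ∧
  (∀ (ι : Type u) (f : ι → Struc L), (∀ i, f i ∈ V) →
    (⟨∀ i, (f i).Carrier⟩ : Struc L) ∈ V)

variable {L}

/-- `Q` is relatively congruence-distributive: `Con_Q A` is a distributive lattice
for every `A ∈ Q`. -/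
def RelCongDist (Q : Set (Struc L)) : Prop :=
  ∀ A ∈ Q, ∀ θ ∈ ConQ Q A, ∀ φ ∈ ConQ Q A, ∀ ψ ∈ ConQ Q A,
    θ ∩ joinQ Q A φ ψ = joinQ Q A (θ ∩ φ) (θ ∩ ψ)

/-- Relation composition `Θ ∘ Φ = {(a,c) : ∃ b, (a,b) ∈ Φ ∧ (b,c) ∈ Θ}`. -/
def relComp {α : Type u} (Θ Φ : Set (α × α)) : Set (α × α) :=
  {p | ∃ b, (p.1, b) ∈ Φ ∧ (b, p.2) ∈ Θ}

/-- `Q` is relatively congruence-permutable. -/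
def RelCongPerm (Q : Set (Struc L)) : Prop :=
  ∀ A ∈ Q, ∀ θ ∈ ConQ Q A, ∀ φ ∈ ConQ Q A, relComp θ φ = relComp φ θ

/-- A class `K` is closed under substructures. -/
def SubClosed (K : Set (Struc L)) : Prop :=
  ∀ B ∈ K, ∀ S : L.Substructure B.Carrier, ofSub B S ∈ K

/-- A class `K` is closed under isomorphisms. -/
def IsoClosed (K : Set (Struc L)) : Prop :=
  ∀ A ∈ K, ∀ B : Struc L, Nonempty (A.Carrier ≃[L] B.Carrier) → B ∈ K

/-- A universal class: closed under isomorphisms, substructures, and ultraproducts. -/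
def IsUniversalClass (K : Set (Struc L)) : Prop :=
  IsoClosed K ∧ SubClosed K ∧
  (∀ (ι : Type u) (f : ι → Struc L) (U : Ultrafilter ι), (∀ i, f i ∈ K) →
    (⟨(U : Filter ι).Product fun i => (f i).Carrier⟩ : Struc L) ∈ K)

/-- The extension property for a class `K`. -/
def HasEP (K : Set (Struc L)) : Prop :=
  ∀ A ∈ K, ∀ B ∈ K, ∀ C ∈ K,
    ∀ (φB : A.Carrier →[L] B.Carrier) (φC : A.Carrier →[L] C.Carrier),
      Function.Injective φB → Function.Surjective φC →
      ∃ D ∈ K, ∃ (ψB : B.Carrier →[L] D.Carrier) (ψC : C.Carrier →[L] D.Carrier),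
        Function.Injective ψC ∧ ∀ a, ψB (φB a) = ψC (φC a)

/-- The one-sided amalgamation property for a class `K`. -/
def Has1AP (K : Set (Struc L)) : Prop :=
  ∀ A ∈ K, ∀ B ∈ K, ∀ C ∈ K,
    ∀ (φB : A.Carrier →[L] B.Carrier) (φC : A.Carrier →[L] C.Carrier),
      Function.Injective φB → Function.Injective φC →
      ∃ D ∈ K, ∃ (ψB : B.Carrier →[L] D.Carrier) (ψC : C.Carrier →[L] D.Carrier),
        Function.Injective ψC ∧ ∀ a, ψB (φB a) = ψC (φC a)

/-- Every doubly injective span in `K` has an amalgam in `K'`. -/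
def HasAmalgamIn (K K' : Set (Struc L)) : Prop :=
  ∀ A ∈ K, ∀ B ∈ K, ∀ C ∈ K,
    ∀ (φB : A.Carrier →[L] B.Carrier) (φC : A.Carrier →[L] C.Carrier),
      Function.Injective φB → Function.Injective φC →
      ∃ D ∈ K', ∃ (ψB : B.Carrier →[L] D.Carrier) (ψC : C.Carrier →[L] D.Carrier),
        Function.Injective ψB ∧ Function.Injective ψC ∧ ∀ a, ψB (φB a) = ψC (φC a)

/-- The amalgamation property for a class `K`. -/
def HasAP (K : Set (Struc L)) : Prop := HasAmalgamIn K K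

/-- The transferable injections property for a class `K`. -/
def HasTIP (K : Set (Struc L)) : Prop :=
  ∀ A ∈ K, ∀ B ∈ K, ∀ C ∈ K,
    ∀ (φB : A.Carrier →[L] B.Carrier) (φC : A.Carrier →[L] C.Carrier),
      Function.Injective φB →
      ∃ D ∈ K, ∃ (ψB : B.Carrier →[L] D.Carrier) (ψC : C.Carrier →[L] D.Carrier),
        Function.Injective ψC ∧ ∀ a, ψB (φB a) = ψC (φC a)

/-- Every doubly injective span in `K` has a strong amalgam in `K'`. -/
def HasStrongAmalgamIn (K K' : Set (Struc L)) : Prop :=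
  ∀ A ∈ K, ∀ B ∈ K, ∀ C ∈ K,
    ∀ (φB : A.Carrier →[L] B.Carrier) (φC : A.Carrier →[L] C.Carrier),
      Function.Injective φB → Function.Injective φC →
      ∃ D ∈ K', ∃ (ψB : B.Carrier →[L] D.Carrier) (ψC : C.Carrier →[L] D.Carrier),
        Function.Injective ψB ∧ Function.Injective ψC ∧ (∀ a, ψB (φB a) = ψC (φC a)) ∧
        Set.range (fun a => ψB (φB a)) = Set.range ψB ∩ Set.range ψC

/-- The strong amalgamation property for a class `K`. -/
def HasSAP (K : Set (Struc L)) : Prop := HasStrongAmalgamIn K K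

/-- `φ : A → B` is an epimorphism in the class `K`. -/
def IsEpiIn (K : Set (Struc L)) {A B : Struc L} (φ : A.Carrier →[L] B.Carrier) : Prop :=
  ∀ C ∈ K, ∀ ψ₁ ψ₂ : B.Carrier →[L] C.Carrier,
    ψ₁.comp φ = ψ₂.comp φ → ψ₁ = ψ₂

/-- The class `K` has surjective epimorphisms. -/
def HasSE (K : Set (Struc L)) : Prop :=
  ∀ A ∈ K, ∀ B ∈ K, ∀ φ : A.Carrier →[L] B.Carrier,
    IsEpiIn K φ → Function.Surjective φ

/-- A substructure `S` of `B` is a retract of `B`. -/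
def IsRetract (B : Struc L) (S : L.Substructure B.Carrier) : Prop :=
  ∃ ψ : B.Carrier →[L] (ofSub B S).Carrier, ∀ a : (ofSub B S).Carrier, ψ (a : B.Carrier) = a


/-- The smallest variety containing `V₁ ∪ V₂`. -/
def varJoin (L : FirstOrder.Language.{u, u}) (V₁ V₂ : Set (Struc L)) : Set (Struc L) :=
  ⋂₀ {W | IsVariety L W ∧ V₁ ⊆ W ∧ V₂ ⊆ W}

/-- An arbitrary intersection of `Q`-congruences is a `Q`-congruence. -/
theorem sInter_mem_ConQ {L : FirstOrder.Language.{u, u}} [L.IsAlgebraic]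
    {Q : Set (Struc L)} (hQ : IsQuasivariety L Q) {A : Struc L}
    {T : Set (Set (A.Carrier × A.Carrier))} (hT : T ⊆ ConQ Q A) : ⋂₀ T ∈ ConQ Q A := by
  choose M hM f hf using fun t : T => hT t.2
  refine ⟨⟨∀ t, (M t).Carrier⟩, hQ.2.2.1 T M hM,
    { toFun := fun a t => f t a
      map_fun' := fun g x => funext fun t => (f t).map_fun g x
      map_rel' := fun r => isEmptyElim r }, ?_⟩
  ext ⟨a, b⟩
  have key : ∀ t : T, (a, b) ∈ t.1 ↔ f t a = f t b := fun t => by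
    conv_lhs => rw [hf t]
    rfl
  rw [mem_sInter]
  exact ⟨fun h => funext fun t => (key t).1 (h t t.2),
    fun h t ht => (key ⟨t, ht⟩).2 (congrFun h ⟨t, ht⟩)⟩

/-- The union of a nonempty chain of `Q`-congruences is a `Q`-congruence. -/
theorem sUnion_mem_ConQ {L : FirstOrder.Language.{u, u}} [L.IsAlgebraic]
    {Q : Set (Struc L)} (hQ : IsQuasivariety L Q) {A : Struc L}
    {c : Set (Set (A.Carrier × A.Carrier))} (hc : c ⊆ ConQ Q A)
    (hchain : IsChain (· ⊆ ·) c) (hne : c.Nonempty) : ⋃₀ c ∈ ConQ Q A := by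
  choose M hM f hf using fun t : c => hc t.2
  have : Nonempty c := hne.to_subtype
  have : IsDirectedOrder c := ⟨fun s t => (hchain.total s.2 t.2).elim
    (fun h => ⟨t, h, le_rfl⟩) (fun h => ⟨s, le_rfl, h⟩)⟩
  let U : Ultrafilter c := Ultrafilter.of Filter.atTop
  have hU : (U : Filter c) ≤ Filter.atTop := Ultrafilter.of_le _
  refine ⟨⟨(U : Filter c).Product fun t => (M t).Carrier⟩, hQ.2.2.2 c M U hM,
    { toFun := fun a => Quotient.mk _ fun t => f t a
      map_fun' := fun {n} g x => ?_
      map_rel' := fun r => isEmptyElim r }, ?_⟩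
  · refine Eq.trans ?_ (Ultraproduct.funMap_cast g fun i t => f t (x i)).symm
    exact congrArg _ (funext fun t => (f t).map_fun g x)
  ext ⟨a, b⟩
  have key : ∀ t : c, (a, b) ∈ t.1 ↔ f t a = f t b := fun t => by
    conv_lhs => rw [hf t]
    rfl
  refine Iff.trans ?_ (Quotient.eq (r := (U : Filter c).productSetoid _)).symm
  change _ ↔ ∀ᶠ t in (U : Filter c), f t a = f t b
  constructor
  · rintro ⟨s, hs, hab⟩
    exact ((Filter.eventually_ge_atTop (⟨s, hs⟩ : c)).filter_mono hU).mono
      fun t hst => (key t).1 (hst hab)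
  · intro h
    obtain ⟨t, ht⟩ := h.exists
    exact ⟨t, t.2, (key t).2 ht⟩

/-- The restriction of a `Q`-congruence to a substructure is a `Q`-congruence. -/
theorem restrict_mem_ConQ {L : FirstOrder.Language.{u, u}} {Q : Set (Struc L)} {B : Struc L}
    (S : L.Substructure B.Carrier) {Φ : Set (B.Carrier × B.Carrier)} (hΦ : Φ ∈ ConQ Q B) :
    restrict S Φ ∈ ConQ Q (ofSub B S) := by
  obtain ⟨M, hM, f, rfl⟩ := hΦ
  exact ⟨M, hM, f.comp S.subtype.toHom, rfl⟩

/-- Lemma 2.6: a meet-irreducible `Θ ∈ Con_Q A` with `Cg_Q^B(Θ) ∩ (A×A) = Θ`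
extends to a meet-irreducible `Q`-congruence of `B`. -/
theorem stmt5 (L : FirstOrder.Language.{u, u}) [L.IsAlgebraic]
    (Q : Set (Struc L)) (hQ : IsQuasivariety L Q) (B : Struc L) (hB : B ∈ Q)
    (S : L.Substructure B.Carrier)
    (θ : Set ((ofSub B S).Carrier × (ofSub B S).Carrier))
    (hθ : MeetIrred Q (ofSub B S) θ)
    (hcg : restrict S (cgQ Q B (lift S θ)) = θ) :
    ∃ Φ, MeetIrred Q B Φ ∧ restrict S Φ = θ := by
  have hchains : ∀ c ⊆ {Φ | Φ ∈ ConQ Q B ∧ restrict S Φ = θ}, IsChain (· ⊆ ·) c →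
      c.Nonempty → ∃ ub ∈ {Φ | Φ ∈ ConQ Q B ∧ restrict S Φ = θ}, ∀ s ∈ c, s ⊆ ub := by
    intro c hc hchain hne
    refine ⟨⋃₀ c, ⟨sUnion_mem_ConQ hQ (fun s hs => (hc hs).1) hchain hne, ?_⟩,
      fun s hs => subset_sUnion_of_mem hs⟩
    ext p
    constructor
    · rintro ⟨s, hs, hp⟩
      exact (hc hs).2.subset hp
    · intro hp
      obtain ⟨s, hs⟩ := hne
      exact ⟨s, hs, (hc hs).2.superset hp⟩
  obtain ⟨Φ, -, hΦ⟩ := zorn_subset_nonempty _ hchains (cgQ Q B (lift S θ))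
    ⟨sInter_mem_ConQ hQ fun _ h => h.1, hcg⟩
  refine ⟨Φ, ⟨hΦ.prop.1, fun Φ₁ h₁ Φ₂ h₂ h => ?_⟩, hΦ.prop.2⟩
  have hr : θ = restrict S Φ₁ ∩ restrict S Φ₂ := by
    rw [← hΦ.prop.2, h]
    rfl
  refine (hθ.2 _ (restrict_mem_ConQ S h₁) _ (restrict_mem_ConQ S h₂) hr).imp
    (fun e => hΦ.eq_of_subset ⟨h₁, e.symm⟩ ?_) (fun e => hΦ.eq_of_subset ⟨h₂, e.symm⟩ ?_)
  · exact h.subset.trans inter_subset_left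
  · exact h.subset.trans inter_subset_right

end Transfer
end

section
/- Let Q be a quasivariety. Then Q has the Q-congruence extension property if and only if Q has the extension property. -/
open FirstOrder Language Set

universe u

namespace Transfer

variable (L : FirstOrder.Language.{u, u})

variable {L}

variable (L)

variable {L}

/-- A homomorphism that factors setwise through a surjective homomorphism factors through it
as a homomorphism. -/
theorem exists_hom_factor [L.IsAlgebraic] {A C M : Type u} [L.Structure A] [L.Structure C]
    [L.Structure M] (g : A →[L] M) (p : A →[L] C) (hp : Function.Surjective p)
    (h : ∀ a b, p a = p b → g a = g b) :
    ∃ k : C →[L] M, ∀ a, k (p a) = g a := by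
  choose s hs using hp
  have hk : ∀ a, g (s (p a)) = g a := fun a => h _ _ (hs _)
  refine ⟨⟨fun c => g (s c), fun {n} F x => ?_, fun {n} r => isEmptyElim r⟩, hk⟩
  have hx : x = p ∘ (s ∘ x) := funext fun i => (hs (x i)).symm
  calc g (s (Structure.funMap F x))
      = g (s (p (Structure.funMap F (s ∘ x)))) := by rw [p.map_fun, ← hx]
    _ = g (Structure.funMap F (s ∘ x)) := hk _
    _ = Structure.funMap F (fun i => g (s (x i))) := g.map_fun F _

/-- A class with the `Q`-CEP has the extension property. -/
theorem ClassQCEP.hasEP [L.IsAlgebraic] {Q : Set (Struc L)} (h : ClassQCEP Q Q) : HasEP Q := by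
  intro A _ B hB C hC φB φC hφB hφC
  have hr : Function.Surjective (φB.codRestrict φB.range fun a => ⟨a, rfl⟩) := by
    rintro ⟨_, a, rfl⟩
    exact ⟨a, rfl⟩
  obtain ⟨f, hf⟩ := exists_hom_factor φC (φB.codRestrict φB.range fun a => ⟨a, rfl⟩) hr
    fun a b hab => congrArg φC (hφB (congrArg Subtype.val hab))
  obtain ⟨_, ⟨M, hM, g, rfl⟩, hg⟩ := h B hB φB.range (kerSet f) ⟨C, hC, f, rfl⟩
  have key : ∀ a b, g (φB a) = g (φB b) ↔ φC a = φC b := by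
    intro a b
    rw [← hf a, ← hf b]
    exact Set.ext_iff.mp hg (⟨φB a, a, rfl⟩, ⟨φB b, b, rfl⟩)
  obtain ⟨k, hk⟩ := exists_hom_factor (g.comp φB) φC hφC fun a b => (key a b).mpr
  refine ⟨M, hM, g, k, fun c d hcd => ?_, fun a => (hk a).symm⟩
  obtain ⟨a, rfl⟩ := hφC c
  obtain ⟨b, rfl⟩ := hφC d
  rw [hk, hk] at hcd
  exact (key a b).mp hcd

/-- For a class closed under substructures, the extension property implies the `Q`-CEP. -/
theorem HasEP.classQCEP {Q : Set (Struc L)} (h : HasEP Q) (hS : SubClosed Q) :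
    ClassQCEP Q Q := by
  rintro B hB S _ ⟨M, hM, f, rfl⟩
  obtain ⟨D, hD, ψB, ψC, hψC, hcomm⟩ := h (ofSub B S) (hS B hB S) B hB
    (ofSub M f.range) (hS M hM f.range) S.subtype.toHom
    (f.codRestrict f.range fun a => ⟨a, rfl⟩) Subtype.val_injective
    (by rintro ⟨_, a, rfl⟩; exact ⟨a, rfl⟩)
  refine ⟨kerSet ψB, ⟨D, hD, ψB, rfl⟩, ?_⟩
  ext ⟨s, t⟩
  have hs : ψB (s : B.Carrier) = _ := hcomm s
  have ht : ψB (t : B.Carrier) = _ := hcomm t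
  change ψB (s : B.Carrier) = ψB (t : B.Carrier) ↔ f s = f t
  rw [hs, ht, hψC.eq_iff]
  exact Subtype.ext_iff

/-- Corollary 2.11: a quasivariety `Q` has the `Q`-CEP iff it has the EP. -/
theorem stmt10 (L : FirstOrder.Language.{u, u}) [L.IsAlgebraic]
    (Q : Set (Struc L)) (hQ : IsQuasivariety L Q) :
    ClassQCEP Q Q ↔ HasEP Q := by
  exact ⟨ClassQCEP.hasEP, fun h => h.classQCEP hQ.2.1⟩

end Transfer
end
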